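/- (Associativity of the harmonic product.) Let p₁, p₂, p₃ be harmonic homogeneous polynomials on ℝ³ of degrees n₁, n₂, n₃. Let q₁₂ be the harmonic homogeneous polynomial of degree n₁+n₂ such that p₁p₂ − q₁₂ is divisible by ‖x‖², and let q_L be the harmonic homogeneous polynomial of degree n₁+n₂+n₃ such that q₁₂p₃ − q_L is divisible by ‖x‖². Similarly, let q₂₃ be harmonic with p₂p₃ − q₂₃ divisible by ‖x‖², and q_R harmonic with p₁q₂₃ − q_R divisible by ‖x‖². Then q_L = q_R; that is, (p₁ ∗ p₂) ∗ p₃ = p₁ ∗ (p₂ ∗ p₃). -/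

import Mathlib

open MvPolynomial

/-- The Laplacian of a polynomial in three variables. -/
noncomputable def lap3 (p : MvPolynomial (Fin 3) ℝ) : MvPolynomial (Fin 3) ℝ :=
  ∑ i : Fin 3, pderiv i (pderiv i p)

/-- The polynomial `‖x‖² = x₁² + x₂² + x₃²`. -/
noncomputable def normSq3 : MvPolynomial (Fin 3) ℝ :=
  ∑ i : Fin 3, X i ^ 2

/-- The Fischer pairing with `q`: the linear functional sending the monomial `x ^ a` to `a!` times
the coefficient of `x ^ a` in `q`. -/
noncomputable def fischerPairing {σ : Type*} [Fintype σ] (q : MvPolynomial σ ℝ) :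
    MvPolynomial σ ℝ →ₗ[ℝ] ℝ :=
  (basisMonomials σ ℝ).constr ℝ fun a => coeff a q * ∏ i, ((a i).factorial : ℝ)

theorem fischerPairing_monomial {σ : Type*} [Fintype σ] (q : MvPolynomial σ ℝ)
    (a : σ →₀ ℕ) (c : ℝ) :
    fischerPairing q (monomial a c) = c * (coeff a q * ∏ i, ((a i).factorial : ℝ)) := by
  have h : monomial a c = c • basisMonomials σ ℝ a := by
    simp [coe_basisMonomials, smul_monomial]
  rw [h, map_smul, fischerPairing, Module.Basis.constr_basis, smul_eq_mul]

theorem fischerPairing_zero {σ : Type*} [Fintype σ] (p : MvPolynomial σ ℝ) :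
    fischerPairing 0 p = 0 := by
  induction p using MvPolynomial.induction_on' with
  | monomial a c => simp [fischerPairing_monomial]
  | add p q hp hq => rw [map_add, hp, hq, add_zero]

theorem fischerPairing_add {σ : Type*} [Fintype σ] (q₁ q₂ p : MvPolynomial σ ℝ) :
    fischerPairing (q₁ + q₂) p = fischerPairing q₁ p + fischerPairing q₂ p := by
  induction p using MvPolynomial.induction_on' with
  | monomial a c => simp only [fischerPairing_monomial, coeff_add]; ring
  | add p q hp hq => simp only [map_add, hp, hq]; ring

theorem prod_factorial_add_single {σ : Type*} [Fintype σ] (a : σ →₀ ℕ) (i : σ) :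
    ∏ j, (((a + Finsupp.single i 1 : σ →₀ ℕ) j).factorial : ℝ) =
      (a i + 1) * ∏ j, ((a j).factorial : ℝ) := by
  classical
  rw [← Finset.mul_prod_erase _ _ (Finset.mem_univ i),
    ← Finset.mul_prod_erase _ (fun j => ((a j).factorial : ℝ)) (Finset.mem_univ i), ← mul_assoc]
  congr 1
  · simp [Nat.factorial_succ]
  · refine Finset.prod_congr rfl fun j hj => ?_
    simp [Finsupp.single_eq_of_ne (Finset.ne_of_mem_erase hj)]

/-- Multiplication by a variable is adjoint to the partial derivative. -/
theorem fischerPairing_X_mul {σ : Type*} [Fintype σ] (q p : MvPolynomial σ ℝ) (i : σ) :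
    fischerPairing q (X i * p) = fischerPairing (pderiv i q) p := by
  induction p using MvPolynomial.induction_on' with
  | monomial a c =>
    rw [X, monomial_mul, one_mul, add_comm, fischerPairing_monomial, fischerPairing_monomial,
      prod_factorial_add_single, coeff_pderiv]
    ring
  | add p q hp hq => rw [mul_add, map_add, map_add, hp, hq]

theorem fischerPairing_self {σ : Type*} [Fintype σ] (p : MvPolynomial σ ℝ) :
    fischerPairing p p = ∑ a ∈ p.support, coeff a p ^ 2 * ∏ i, ((a i).factorial : ℝ) := by
  conv_lhs => rw [p.as_sum, map_sum, ← p.as_sum]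
  refine Finset.sum_congr rfl fun a _ => ?_
  rw [fischerPairing_monomial]
  ring

theorem eq_zero_of_fischerPairing_self {σ : Type*} [Fintype σ] {p : MvPolynomial σ ℝ}
    (h : fischerPairing p p = 0) : p = 0 := by
  have hw (a : σ →₀ ℕ) : 0 < ∏ i, ((a i).factorial : ℝ) :=
    Finset.prod_pos fun i _ => by exact_mod_cast (a i).factorial_pos
  rw [fischerPairing_self, Finset.sum_eq_zero_iff_of_nonneg
    fun a _ => mul_nonneg (sq_nonneg _) (hw a).le] at h
  ext a
  by_contra ha
  exact mul_ne_zero (pow_ne_zero 2 ha) (hw a).ne' (h a (mem_support_iff.mpr ha))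

/-- Multiplication by `‖x‖²` is adjoint to the Laplacian. -/
theorem fischerPairing_normSq3_mul (q p : MvPolynomial (Fin 3) ℝ) :
    fischerPairing q (normSq3 * p) = fischerPairing (lap3 q) p := by
  simp only [normSq3, lap3, Fin.sum_univ_three, add_mul, map_add, sq, mul_assoc,
    fischerPairing_X_mul, fischerPairing_add]

theorem eq_zero_of_lap3_eq_zero_of_normSq3_dvd {p : MvPolynomial (Fin 3) ℝ}
    (hp : lap3 p = 0) (hd : normSq3 ∣ p) : p = 0 := by
  obtain ⟨g, hg⟩ := hd
  apply eq_zero_of_fischerPairing_self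
  calc fischerPairing p p = fischerPairing p (normSq3 * g) := by rw [← hg]
    _ = 0 := by rw [fischerPairing_normSq3_mul, hp, fischerPairing_zero]

theorem lap3_sub (p q : MvPolynomial (Fin 3) ℝ) : lap3 (p - q) = lap3 p - lap3 q := by
  simp only [lap3, map_sub, Finset.sum_sub_distrib]

/-- **Associativity of the harmonic product.** If `q₁₂` is the harmonic part of `p₁p₂`, `q_L`
the harmonic part of `q₁₂p₃`, `q₂₃` the harmonic part of `p₂p₃` and `q_R` the harmonic part
of `p₁q₂₃`, then `q_L = q_R`, i.e. `(p₁ ∗ p₂) ∗ p₃ = p₁ ∗ (p₂ ∗ p₃)`. -/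
theorem harmonic_product_assoc (n₁ n₂ n₃ : ℕ)
    (p₁ p₂ p₃ q₁₂ qL q₂₃ qR : MvPolynomial (Fin 3) ℝ)
    (hp₁ : p₁.IsHomogeneous n₁) (hp₁h : lap3 p₁ = 0)
    (hp₂ : p₂.IsHomogeneous n₂) (hp₂h : lap3 p₂ = 0)
    (hp₃ : p₃.IsHomogeneous n₃) (hp₃h : lap3 p₃ = 0)
    (hq₁₂ : q₁₂.IsHomogeneous (n₁ + n₂)) (hq₁₂h : lap3 q₁₂ = 0)
    (hd₁₂ : normSq3 ∣ p₁ * p₂ - q₁₂)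
    (hqL : qL.IsHomogeneous (n₁ + n₂ + n₃)) (hqLh : lap3 qL = 0)
    (hdL : normSq3 ∣ q₁₂ * p₃ - qL)
    (hq₂₃ : q₂₃.IsHomogeneous (n₂ + n₃)) (hq₂₃h : lap3 q₂₃ = 0)
    (hd₂₃ : normSq3 ∣ p₂ * p₃ - q₂₃)
    (hqR : qR.IsHomogeneous (n₁ + n₂ + n₃)) (hqRh : lap3 qR = 0)
    (hdR : normSq3 ∣ p₁ * q₂₃ - qR) :
    qL = qR := by
  refine sub_eq_zero.mp (eq_zero_of_lap3_eq_zero_of_normSq3_dvd ?_ ?_)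
  · rw [lap3_sub, hqLh, hqRh, sub_zero]
  · have h := (((hd₂₃.mul_left p₁).add hdR).sub (hd₁₂.mul_right p₃)).sub hdL
    convert h using 1
    ring
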